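/- For every m ≥ 1 and every 1 ≤ k ≤ 5^m, one has λ_k(m+1) = φ₁(λ_k(m)); that is, the 5^m smallest eigenvalues (with multiplicity) of −Δ_{m+1} are obtained by applying φ₁ to the eigenvalues (with multiplicity) of −Δ_m. -/

import Mathlib

open scoped BigOperators

noncomputable section

namespace VNLE

/-- `N_m = 2·5^m`, the number of points on the circle at level `m`. -/
def Nm (m : ℕ) : ℕ := 2 * 5 ^ m

/-- The partner of a vertex `n` of `K_m`: writing the representative `v` of `n`
(taking `v = 2·5^m` when `n = 0`) as `v = 5^k·a` with `5 ∤ a`, the partner is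
`n + 5^k` if `a ≡ 1` or `3 (mod 5)`, and `n - 5^k` if `a ≡ 2` or `4 (mod 5)`.
This realizes the identifications `5^k(1+5j) ∼ 5^k(2+5j)` and
`5^k(3+5j) ∼ 5^k(4+5j)` in `ℤ/(2·5^m)ℤ`. -/
def partner (m : ℕ) (n : ZMod (Nm m)) : ZMod (Nm m) :=
  let v : ℕ := if n.val = 0 then Nm m else n.val
  let k : ℕ := padicValNat 5 v
  if (v / 5 ^ k) % 5 = 1 ∨ (v / 5 ^ k) % 5 = 3 then n + ((5 ^ k : ℕ) : ZMod (Nm m))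
  else n - ((5 ^ k : ℕ) : ZMod (Nm m))

/-- A function on `K_m`: a map on `ℤ/N_mℤ` constant on the identified pairs. -/
def IsKFun (m : ℕ) (u : ZMod (Nm m) → ℝ) : Prop := ∀ n, u (partner m n) = u n

/-- The graph Laplacian `−Δ_m`. -/
def lap (m : ℕ) (u : ZMod (Nm m) → ℝ) : ZMod (Nm m) → ℝ := fun n =>
  4 * u n - u (n + 1) - u (n - 1) - u (partner m n + 1) - u (partner m n - 1)

/-- `u` is a `λ`-eigenfunction of `−Δ_m`. -/
def IsEigen (m : ℕ) (lam : ℝ) (u : ZMod (Nm m) → ℝ) : Prop :=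
  IsKFun m u ∧ u ≠ 0 ∧ ∀ n, lap m u n = lam * u n

/-- The spectral decimation renormalization polynomial `R(x) = x(3−x)(5−x)`. -/
def R (x : ℝ) : ℝ := x * (3 - x) * (5 - x)

/-- The `λ'`-extension of a function on `K_m` to a function on `K_{m+1}`. -/
def extFun (m : ℕ) (lam' : ℝ) (u : ZMod (Nm m) → ℝ) : ZMod (Nm (m + 1)) → ℝ := fun x =>
  let n : ZMod (Nm m) := ((x.val / 5 : ℕ) : ZMod (Nm m))
  if x.val % 5 = 0 then u n
  else if x.val % 5 = 1 ∨ x.val % 5 = 2 then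
    ((2 - lam') * u n + u (n + 1)) / ((1 - lam') * (3 - lam'))
  else
    (u n + (2 - lam') * u (n + 1)) / ((1 - lam') * (3 - lam'))

/-- Restriction of a function on `K_{m+1}` to the old vertices, giving a function on `K_m`. -/
def down (m : ℕ) (v : ZMod (Nm (m + 1)) → ℝ) : ZMod (Nm m) → ℝ := fun n =>
  v (((5 * n.val : ℕ) : ZMod (Nm (m + 1))))

/-- The Laplacian `−Δ_m` as a linear map. -/
def lapL (m : ℕ) : (ZMod (Nm m) → ℝ) →ₗ[ℝ] (ZMod (Nm m) → ℝ) where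
  toFun := lap m
  map_add' u v := by funext n; simp only [lap, Pi.add_apply]; ring
  map_smul' c u := by funext n; simp only [lap, Pi.smul_apply, smul_eq_mul, RingHom.id_apply]; ring

/-- The subspace of functions on `K_m` (maps constant on identified pairs). -/
def KFunSub (m : ℕ) : Submodule ℝ (ZMod (Nm m) → ℝ) where
  carrier := {u | IsKFun m u}
  add_mem' := by
    intro u v hu hv n
    simp only [Pi.add_apply, hu n, hv n]
  zero_mem' := fun _ => rfl
  smul_mem' := by
    intro c u hu n
    simp only [Pi.smul_apply, hu n]

/-- The `λ`-eigenspace of `−Δ_m` inside the space of functions on `K_m`. -/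
def eigensp (m : ℕ) (lam : ℝ) : Submodule ℝ (ZMod (Nm m) → ℝ) :=
  LinearMap.ker (lapL m - lam • LinearMap.id) ⊓ KFunSub m

/-- `c = (8 − √19)/3`, the smaller critical point of `R`. -/
def cpt : ℝ := (8 - Real.sqrt 19) / 3

/-- `φ₁`, the inverse of the (strictly increasing) restriction of `R` to `[0, c]`. -/
def phi1 : ℝ → ℝ := Function.invFunOn R (Set.Icc 0 cpt)

/-- Eigenvalue counting function: total dimension of the eigenspaces of `−Δ_m`
with eigenvalue `≤ t`. -/
def evCount (m : ℕ) (t : ℝ) : ℕ :=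
  Module.finrank ℝ ↥(⨆ lam ∈ Set.Iic t, eigensp m lam)

/-- `evSorted m k = λ_k(m)`, the `k`-th smallest eigenvalue (with multiplicity,
`1 ≤ k ≤ 5^m`) of `−Δ_m` acting on functions on `K_m`. -/
def evSorted (m k : ℕ) : ℝ := sInf {t : ℝ | k ≤ evCount m t}

/-- The restriction of a function on the circle `ℝ/ℤ` to the level-`m` vertices. -/
def restr (u : AddCircle (1 : ℝ) → ℝ) (m : ℕ) : ZMod (Nm m) → ℝ := fun n =>
  u (((n.val : ℝ) / (Nm m : ℝ) : ℝ) : AddCircle (1 : ℝ))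

/-- A continuous function on the circle is admissible if at every level its values
agree on identified pairs, so that its restrictions are functions on `K_m`. -/
def Admissible (u : AddCircle (1 : ℝ) → ℝ) : Prop :=
  Continuous u ∧ ∀ m, 1 ≤ m → ∀ n : ZMod (Nm m), restr u m (partner m n) = restr u m n

/-- `u` is a `λ`-eigenfunction of `−Δ` on `K`: it is admissible, nonzero, and
`sup_n |15^m (−Δ_m u_m)(n) − λ u(n/N_m)| → 0` as `m → ∞`. -/
def IsEigenK (lam : ℝ) (u : AddCircle (1 : ℝ) → ℝ) : Prop :=
  Admissible u ∧ u ≠ 0 ∧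
    ∀ ε : ℝ, 0 < ε → ∃ M : ℕ, ∀ m, M ≤ m → ∀ n : ZMod (Nm m),
      |(15 : ℝ) ^ m * lap m (restr u m) n - lam * restr u m n| < ε

/-- The symmetry-type subspace `V_{ε₁,ε₂}` of functions on `K_m`. -/
def symSub (m : ℕ) (e1 e2 : ℝ) : Submodule ℝ (ZMod (Nm m) → ℝ) where
  carrier := {u | IsKFun m u ∧ (∀ n, u (-n) = e1 * u n) ∧
    (∀ n, u (((5 ^ m : ℕ) : ZMod (Nm m)) - n) = e2 * u n)}
  add_mem' := by
    rintro u v ⟨hu, hu1, hu2⟩ ⟨hv, hv1, hv2⟩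
    refine ⟨fun n => by simp only [Pi.add_apply, hu n, hv n],
      fun n => by simp only [Pi.add_apply, hu1 n, hv1 n]; ring,
      fun n => by simp only [Pi.add_apply, hu2 n, hv2 n]; ring⟩
  zero_mem' := ⟨fun _ => rfl, fun n => by simp, fun n => by simp⟩
  smul_mem' := by
    rintro c u ⟨hu, hu1, hu2⟩
    refine ⟨fun n => by simp only [Pi.smul_apply, hu n],
      fun n => by simp only [Pi.smul_apply, smul_eq_mul, hu1 n]; ring,
      fun n => by simp only [Pi.smul_apply, smul_eq_mul, hu2 n]; ring⟩

instance neZero_Nm (m : ℕ) : NeZero (Nm m) := ⟨by unfold Nm; positivity⟩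

theorem Nm_succ (m : ℕ) : Nm (m + 1) = 5 * Nm m := by
  unfold Nm; ring

/-- The embedding `n ↦ 5n` of the vertices of `K_m` into those of `K_{m+1}`. -/
def old (m : ℕ) (n : ZMod (Nm m)) : ZMod (Nm (m + 1)) := ((5 * n.val : ℕ) : ZMod (Nm (m + 1)))

theorem old_natCast (m a : ℕ) : old m (a : ZMod (Nm m)) = ((5 * a : ℕ) : ZMod (Nm (m + 1))) := by
  rw [old, ZMod.natCast_eq_natCast_iff', ZMod.val_natCast, Nm_succ, Nat.mul_mod_mul_left,
    Nat.mul_mod_mul_left, Nat.mod_mod]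

theorem old_add (m : ℕ) (a b : ZMod (Nm m)) : old m (a + b) = old m a + old m b := by
  rw [← ZMod.natCast_zmod_val a, ← ZMod.natCast_zmod_val b, ← Nat.cast_add, old_natCast,
    old_natCast, old_natCast]
  push_cast; ring

theorem old_sub (m : ℕ) (a b : ZMod (Nm m)) : old m (a - b) = old m a - old m b := by
  rw [eq_sub_iff_add_eq, ← old_add, sub_add_cancel]

theorem old_one (m : ℕ) : old m 1 = 5 := by
  simpa using old_natCast m 1

theorem val_old_add (m : ℕ) (n : ZMod (Nm m)) {r : ℕ} (hr : r < 5) :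
    (old m n + (r : ZMod (Nm (m + 1)))).val = 5 * n.val + r := by
  rw [old, ← Nat.cast_add, ZMod.val_natCast, Nat.mod_eq_of_lt]
  have := ZMod.val_lt n
  have := Nm_succ m
  omega

theorem val_old (m : ℕ) (n : ZMod (Nm m)) : (old m n).val = 5 * n.val := by
  simpa using val_old_add m n (r := 0) (by norm_num)

theorem exists_old_add (m : ℕ) (x : ZMod (Nm (m + 1))) :
    ∃ n : ZMod (Nm m), ∃ r : ℕ, r < 5 ∧ x = old m n + (r : ZMod (Nm (m + 1))) := by
  refine ⟨((x.val / 5 : ℕ) : ZMod (Nm m)), x.val % 5, Nat.mod_lt _ (by norm_num), ?_⟩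
  rw [old_natCast, ← Nat.cast_add, Nat.div_add_mod, ZMod.natCast_zmod_val]

theorem partner_old (m : ℕ) (n : ZMod (Nm m)) :
    partner (m + 1) (old m n) = old m (partner m n) := by
  simp only [partner, val_old, Nm_succ, mul_eq_zero, OfNat.ofNat_ne_zero, false_or]
  rw [← mul_ite]
  have hv : (if n.val = 0 then Nm m else n.val) ≠ 0 := by
    split_ifs with h
    · exact NeZero.ne _
    · exact h
  generalize (if n.val = 0 then Nm m else n.val) = v at hv
  have hp : padicValNat 5 (5 * v) = padicValNat 5 v + 1 := by
    have : Fact (Nat.Prime 5) := ⟨by norm_num⟩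
    rw [padicValNat.mul (by norm_num) hv, padicValNat_self, add_comm]
  have hd : 5 * v / 5 ^ (padicValNat 5 v + 1) = v / 5 ^ padicValNat 5 v := by
    rw [pow_succ', Nat.mul_div_mul_left _ _ (by norm_num)]
  rw [hp, hd]
  split_ifs
  · rw [old_add, old_natCast, pow_succ']
  · rw [old_sub, old_natCast, pow_succ']

theorem partner_old_add (m : ℕ) (n : ZMod (Nm m)) {r : ℕ} (hr : r < 5) (hr0 : r ≠ 0) :
    partner (m + 1) (old m n + (r : ZMod (Nm (m + 1)))) =
      if r = 1 ∨ r = 3 then old m n + (r : ZMod (Nm (m + 1))) + 1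
      else old m n + (r : ZMod (Nm (m + 1))) - 1 := by
  simp only [partner, val_old_add m n hr]
  have h0 : 5 * n.val + r ≠ 0 := by omega
  have hp : padicValNat 5 (5 * n.val + r) = 0 :=
    padicValNat.eq_zero_of_not_dvd (by omega)
  have hm : (5 * n.val + r) % 5 = r := by omega
  simp only [h0, if_false, hp, pow_zero, Nat.div_one, hm, Nat.cast_one]

theorem partner_old_one (m : ℕ) (n : ZMod (Nm m)) :
    partner (m + 1) (old m n + 1) = old m n + 2 := by
  have h := partner_old_add m n (r := 1) (by norm_num) (by norm_num)
  norm_num [add_assoc] at h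
  exact h

theorem partner_old_two (m : ℕ) (n : ZMod (Nm m)) :
    partner (m + 1) (old m n + 2) = old m n + 1 := by
  have h := partner_old_add m n (r := 2) (by norm_num) (by norm_num)
  norm_num [add_sub_assoc] at h
  exact h

theorem partner_old_three (m : ℕ) (n : ZMod (Nm m)) :
    partner (m + 1) (old m n + 3) = old m n + 4 := by
  have h := partner_old_add m n (r := 3) (by norm_num) (by norm_num)
  norm_num [add_assoc] at h
  exact h

theorem partner_old_four (m : ℕ) (n : ZMod (Nm m)) :
    partner (m + 1) (old m n + 4) = old m n + 3 := by
  have h := partner_old_add m n (r := 4) (by norm_num) (by norm_num)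
  norm_num [add_sub_assoc] at h
  exact h

theorem forall_old (m : ℕ) {P : ZMod (Nm (m + 1)) → Prop}
    (h0 : ∀ n, P (old m n)) (h1 : ∀ n, P (old m n + 1)) (h2 : ∀ n, P (old m n + 2))
    (h3 : ∀ n, P (old m n + 3)) (h4 : ∀ n, P (old m n + 4)) (x) : P x := by
  obtain ⟨n, r, hr, rfl⟩ := exists_old_add m x
  interval_cases r
  · simpa using h0 n
  · simpa using h1 n
  · simpa using h2 n
  · simpa using h3 n
  · simpa using h4 n

theorem partner_partner (m : ℕ) (n : ZMod (Nm m)) : partner m (partner m n) = n := by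
  induction m with
  | zero =>
    have h1 : partner 0 1 = 0 := by
      have : (1 : ZMod (Nm 0)).val = 1 := rfl
      simp only [partner, this]
      norm_num
      rfl
    have h0 : partner 0 0 = 1 := by
      have h : padicValNat 5 2 = 0 := padicValNat.eq_zero_of_not_dvd (by norm_num)
      simp only [partner, ZMod.val_zero, if_true]
      norm_num [Nm, h]
      rfl
    have h : n = 0 ∨ n = 1 := by
      change ZMod 2 at n
      change n = (0 : ZMod 2) ∨ n = (1 : ZMod 2)
      revert n; decide
    rcases h with rfl | rfl
    · rw [h0, h1]
    · rw [h1, h0]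
  | succ m ih =>
    revert n
    apply forall_old <;> intro n
    · rw [partner_old, partner_old, ih]
    · rw [partner_old_one, partner_old_two]
    · rw [partner_old_two, partner_old_one]
    · rw [partner_old_three, partner_old_four]
    · rw [partner_old_four, partner_old_three]

theorem two_dvd_Nm (m : ℕ) : 2 ∣ Nm m := Dvd.intro _ rfl

theorem castHom_partner (m : ℕ) (n : ZMod (Nm m)) :
    ZMod.castHom (two_dvd_Nm m) (ZMod 2) (partner m n) =
      ZMod.castHom (two_dvd_Nm m) (ZMod 2) n + 1 := by
  have h5 : (5 : ZMod 2) = 1 := by decide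
  have hn : ∀ a : ZMod 2, a - 1 = a + 1 := by decide
  simp only [partner]
  generalize (if n.val = 0 then Nm m else n.val) = v
  split_ifs
  · rw [map_add, map_natCast]; push_cast; rw [h5, one_pow]
  · rw [map_sub, map_natCast]; push_cast; rw [h5, one_pow, hn]

theorem val_partner_even_iff (m : ℕ) (n : ZMod (Nm m)) :
    Even (partner m n).val ↔ ¬ Even n.val := by
  have key : ∀ x : ZMod (Nm m),
      Even x.val ↔ ZMod.castHom (two_dvd_Nm m) (ZMod 2) x = 0 := by
    intro x
    rw [← ZMod.natCast_eq_zero_iff_even]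
    conv_rhs => rw [← ZMod.natCast_zmod_val x, map_natCast]
  rw [key, key, castHom_partner]
  generalize ZMod.castHom (two_dvd_Nm m) (ZMod 2) n = a
  revert a; decide

theorem mem_eigensp {m : ℕ} {lam : ℝ} {u : ZMod (Nm m) → ℝ} :
    u ∈ eigensp m lam ↔ (∀ n, lap m u n = lam * u n) ∧ ∀ n, u (partner m n) = u n := by
  rw [eigensp, Submodule.mem_inf, LinearMap.mem_ker, LinearMap.sub_apply, sub_eq_zero]
  exact and_congr funext_iff Iff.rfl

/-- Restriction to the old vertices, as a linear map. -/
def downL (m : ℕ) : (ZMod (Nm (m + 1)) → ℝ) →ₗ[ℝ] (ZMod (Nm m) → ℝ) :=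
  LinearMap.funLeft ℝ ℝ (old m)

theorem downL_apply (m : ℕ) (v : ZMod (Nm (m + 1)) → ℝ) (n : ZMod (Nm m)) :
    downL m v n = v (old m n) := rfl

theorem old_add_one (m : ℕ) (n : ZMod (Nm m)) : old m (n + 1) = old m n + 5 := by
  rw [old_add, old_one]

theorem old_sub_one (m : ℕ) (n : ZMod (Nm m)) : old m n - 1 = old m (n - 1) + 4 := by
  rw [old_sub, old_one]; ring

theorem lap_old (m : ℕ) (v : ZMod (Nm (m + 1)) → ℝ) (n : ZMod (Nm m)) :
    lap (m + 1) v (old m n) = 4 * v (old m n) - v (old m n + 1) - v (old m (n - 1) + 4)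
      - v (old m (partner m n) + 1) - v (old m (partner m n - 1) + 4) := by
  rw [lap, partner_old, old_sub_one, old_sub_one]

theorem lap_old_one (m : ℕ) (v : ZMod (Nm (m + 1)) → ℝ) (n : ZMod (Nm m)) :
    lap (m + 1) v (old m n + 1) = 4 * v (old m n + 1) - v (old m n + 2) - v (old m n)
      - v (old m n + 3) - v (old m n + 1) := by
  rw [lap, partner_old_one]; ring_nf

theorem lap_old_two (m : ℕ) (v : ZMod (Nm (m + 1)) → ℝ) (n : ZMod (Nm m)) :
    lap (m + 1) v (old m n + 2) = 4 * v (old m n + 2) - v (old m n + 3) - v (old m n + 1)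
      - v (old m n + 2) - v (old m n) := by
  rw [lap, partner_old_two]; ring_nf

theorem lap_old_three (m : ℕ) (v : ZMod (Nm (m + 1)) → ℝ) (n : ZMod (Nm m)) :
    lap (m + 1) v (old m n + 3) = 4 * v (old m n + 3) - v (old m n + 4) - v (old m n + 2)
      - v (old m (n + 1)) - v (old m n + 3) := by
  rw [lap, partner_old_three, old_add_one]; ring_nf

theorem lap_old_four (m : ℕ) (v : ZMod (Nm (m + 1)) → ℝ) (n : ZMod (Nm m)) :
    lap (m + 1) v (old m n + 4) = 4 * v (old m n + 4) - v (old m (n + 1)) - v (old m n + 3)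
      - v (old m n + 4) - v (old m n + 2) := by
  rw [lap, partner_old_four, old_add_one]; ring_nf

/-- The values of an eigenfunction at the new vertices are determined by its values at the old
vertices. -/
theorem new_values {m : ℕ} {mu : ℝ} {v : ZMod (Nm (m + 1)) → ℝ} (hv : v ∈ eigensp (m + 1) mu)
    (n : ZMod (Nm m)) :
    v (old m n + 2) = v (old m n + 1) ∧ v (old m n + 3) = v (old m n + 4) ∧
    (1 - mu) * (3 - mu) * v (old m n + 1) = (2 - mu) * v (old m n) + v (old m (n + 1)) ∧
    (1 - mu) * (3 - mu) * v (old m n + 4) = v (old m n) + (2 - mu) * v (old m (n + 1)) := by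
  obtain ⟨hl, hp⟩ := mem_eigensp.1 hv
  have h1 := hl (old m n + 1)
  have h4 := hl (old m n + 4)
  have p1 := hp (old m n + 1)
  have p4 := hp (old m n + 4)
  rw [lap_old_one] at h1
  rw [lap_old_four] at h4
  rw [partner_old_one] at p1
  rw [partner_old_four] at p4
  rw [p1, p4] at h1 h4
  refine ⟨p1, p4, ?_, ?_⟩
  · linear_combination (2 - mu) * h1 + h4
  · linear_combination (2 - mu) * h4 + h1

theorem downL_mem_eigensp {m : ℕ} {mu : ℝ} {v : ZMod (Nm (m + 1)) → ℝ}
    (hv : v ∈ eigensp (m + 1) mu) :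
    downL m v ∈ eigensp m (R mu) := by
  obtain ⟨hl, hp⟩ := mem_eigensp.1 hv
  refine mem_eigensp.2 ⟨fun n => ?_, fun n => ?_⟩
  · have h := hl (old m n)
    rw [lap_old] at h
    have e1 := (new_values hv n).2.2.1
    have e2 := (new_values hv (n - 1)).2.2.2
    have e3 := (new_values hv (partner m n)).2.2.1
    have e4 := (new_values hv (partner m n - 1)).2.2.2
    have e5 := hp (old m n)
    rw [partner_old] at e5
    rw [sub_add_cancel] at e2 e4
    rw [e5] at e3 e4
    simp only [lap, downL_apply, R]
    linear_combination (1 - mu) * (3 - mu) * h + e1 + e2 + e3 + e4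
  · rw [downL_apply, downL_apply, ← partner_old, hp]

theorem eq_zero_of_downL_eq_zero {m : ℕ} {mu : ℝ} (hmu : (1 - mu) * (3 - mu) ≠ 0)
    {v : ZMod (Nm (m + 1)) → ℝ} (hv : v ∈ eigensp (m + 1) mu) (h : downL m v = 0) : v = 0 := by
  have h0 : ∀ n, v (old m n) = 0 := fun n => congrFun h n
  have h1 : ∀ n, v (old m n + 1) = 0 := fun n => by
    have e := (new_values hv n).2.2.1
    rw [h0, h0, mul_zero, add_zero] at e
    exact (mul_eq_zero.1 e).resolve_left hmu
  have h4 : ∀ n, v (old m n + 4) = 0 := fun n => by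
    have e := (new_values hv n).2.2.2
    rw [h0, h0, mul_zero, add_zero] at e
    exact (mul_eq_zero.1 e).resolve_left hmu
  funext x
  revert x
  exact forall_old m h0 h1 (fun n => (new_values hv n).1.trans (h1 n))
    (fun n => (new_values hv n).2.1.trans (h4 n)) h4

theorem extFun_old_add (m : ℕ) (mu : ℝ) (u : ZMod (Nm m) → ℝ) (n : ZMod (Nm m)) {r : ℕ}
    (hr : r < 5) :
    extFun m mu u (old m n + (r : ZMod (Nm (m + 1)))) =
      if r = 0 then u n
      else if r = 1 ∨ r = 2 then ((2 - mu) * u n + u (n + 1)) / ((1 - mu) * (3 - mu))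
      else (u n + (2 - mu) * u (n + 1)) / ((1 - mu) * (3 - mu)) := by
  have h1 : (5 * n.val + r) % 5 = r := by omega
  have h2 : (5 * n.val + r) / 5 = n.val := by omega
  simp only [extFun, val_old_add m n hr, h1, h2, ZMod.natCast_zmod_val]

theorem extFun_old (m : ℕ) (mu : ℝ) (u : ZMod (Nm m) → ℝ) (n : ZMod (Nm m)) :
    extFun m mu u (old m n) = u n := by
  simpa using extFun_old_add m mu u n (r := 0) (by norm_num)

theorem extFun_old_one (m : ℕ) (mu : ℝ) (u : ZMod (Nm m) → ℝ) (n : ZMod (Nm m)) :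
    extFun m mu u (old m n + 1) = ((2 - mu) * u n + u (n + 1)) / ((1 - mu) * (3 - mu)) := by
  simpa using extFun_old_add m mu u n (r := 1) (by norm_num)

theorem extFun_old_two (m : ℕ) (mu : ℝ) (u : ZMod (Nm m) → ℝ) (n : ZMod (Nm m)) :
    extFun m mu u (old m n + 2) = ((2 - mu) * u n + u (n + 1)) / ((1 - mu) * (3 - mu)) := by
  simpa using extFun_old_add m mu u n (r := 2) (by norm_num)

theorem extFun_old_three (m : ℕ) (mu : ℝ) (u : ZMod (Nm m) → ℝ) (n : ZMod (Nm m)) :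
    extFun m mu u (old m n + 3) = (u n + (2 - mu) * u (n + 1)) / ((1 - mu) * (3 - mu)) := by
  simpa using extFun_old_add m mu u n (r := 3) (by norm_num)

theorem extFun_old_four (m : ℕ) (mu : ℝ) (u : ZMod (Nm m) → ℝ) (n : ZMod (Nm m)) :
    extFun m mu u (old m n + 4) = (u n + (2 - mu) * u (n + 1)) / ((1 - mu) * (3 - mu)) := by
  simpa using extFun_old_add m mu u n (r := 4) (by norm_num)

theorem extFun_mem_eigensp {m : ℕ} {mu : ℝ} (hmu : (1 - mu) * (3 - mu) ≠ 0)
    {u : ZMod (Nm m) → ℝ} (hu : u ∈ eigensp m (R mu)) :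
    extFun m mu u ∈ eigensp (m + 1) mu := by
  obtain ⟨hl, hp⟩ := mem_eigensp.1 hu
  refine mem_eigensp.2 ⟨forall_old m ?_ ?_ ?_ ?_ ?_, forall_old m ?_ ?_ ?_ ?_ ?_⟩ <;> intro n
  · have h := hl n
    simp only [lap_old, extFun_old, extFun_old_one, extFun_old_four, sub_add_cancel, hp]
    simp only [lap, R] at h
    refine mul_left_cancel₀ hmu ?_
    rw [mul_sub, mul_sub, mul_sub, mul_sub, mul_div_cancel₀ _ hmu, mul_div_cancel₀ _ hmu,
      mul_div_cancel₀ _ hmu, mul_div_cancel₀ _ hmu]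
    linear_combination h
  · rw [lap_old_one, extFun_old, extFun_old_one, extFun_old_two, extFun_old_three]
    refine mul_left_cancel₀ hmu ?_
    generalize hA : ((2 - mu) * u n + u (n + 1)) / ((1 - mu) * (3 - mu)) = A
    generalize hB : (u n + (2 - mu) * u (n + 1)) / ((1 - mu) * (3 - mu)) = B
    rw [div_eq_iff hmu] at hA hB
    linear_combination -(2 - mu) * hA + hB
  · rw [lap_old_two, extFun_old, extFun_old_one, extFun_old_two, extFun_old_three]
    refine mul_left_cancel₀ hmu ?_
    generalize hA : ((2 - mu) * u n + u (n + 1)) / ((1 - mu) * (3 - mu)) = A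
    generalize hB : (u n + (2 - mu) * u (n + 1)) / ((1 - mu) * (3 - mu)) = B
    rw [div_eq_iff hmu] at hA hB
    linear_combination -(2 - mu) * hA + hB
  · rw [lap_old_three, extFun_old, extFun_old_four, extFun_old_two, extFun_old_three]
    refine mul_left_cancel₀ hmu ?_
    generalize hA : ((2 - mu) * u n + u (n + 1)) / ((1 - mu) * (3 - mu)) = A
    generalize hB : (u n + (2 - mu) * u (n + 1)) / ((1 - mu) * (3 - mu)) = B
    rw [div_eq_iff hmu] at hA hB
    linear_combination -(2 - mu) * hB + hA
  · rw [lap_old_four, extFun_old, extFun_old_four, extFun_old_two, extFun_old_three]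
    refine mul_left_cancel₀ hmu ?_
    generalize hA : ((2 - mu) * u n + u (n + 1)) / ((1 - mu) * (3 - mu)) = A
    generalize hB : (u n + (2 - mu) * u (n + 1)) / ((1 - mu) * (3 - mu)) = B
    rw [div_eq_iff hmu] at hA hB
    linear_combination -(2 - mu) * hB + hA
  · rw [partner_old, extFun_old, extFun_old, hp]
  · rw [partner_old_one, extFun_old_one, extFun_old_two]
  · rw [partner_old_two, extFun_old_one, extFun_old_two]
  · rw [partner_old_three, extFun_old_three, extFun_old_four]
  · rw [partner_old_four, extFun_old_three, extFun_old_four]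

theorem map_downL_eigensp {m : ℕ} {mu : ℝ} (hmu : (1 - mu) * (3 - mu) ≠ 0) :
    (eigensp (m + 1) mu).map (downL m) = eigensp m (R mu) := by
  refine le_antisymm (Submodule.map_le_iff_le_comap.2 fun v hv => downL_mem_eigensp hv)
    fun u hu => ⟨extFun m mu u, extFun_mem_eigensp hmu hu, ?_⟩
  funext n
  rw [downL_apply, extFun_old]

theorem partner_one {m : ℕ} (hm : 1 ≤ m) : partner m 1 = 2 := by
  obtain ⟨m, rfl⟩ := Nat.exists_eq_add_of_le' hm
  simpa [old] using partner_old_one m 0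

theorem eigenvalue_nonneg {m : ℕ} {lam : ℝ} {u : ZMod (Nm m) → ℝ} (hu : u ∈ eigensp m lam)
    (h0 : u ≠ 0) : 0 ≤ lam := by
  obtain ⟨hl, -⟩ := mem_eigensp.1 hu
  obtain ⟨n, hn⟩ := Finite.exists_max fun n => |u n|
  have hpos : 0 < |u n| := by
    obtain ⟨k, hk⟩ := Function.ne_iff.1 h0
    exact (abs_pos.2 hk).trans_le (hn k)
  have key : ∀ k, u n * u k ≤ u n ^ 2 := fun k => by
    rw [← sq_abs, sq]
    exact (le_abs_self _).trans ((abs_mul _ _).trans_le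
      (mul_le_mul_of_nonneg_left (hn k) (abs_nonneg _)))
  have h := hl n
  rw [lap] at h
  have h2 : 0 ≤ lam * u n ^ 2 := by
    have e : lam * u n ^ 2 = 4 * u n ^ 2 - u n * u (n + 1) - u n * u (n - 1)
      - u n * u (partner m n + 1) - u n * u (partner m n - 1) := by
      linear_combination -u n * h
    linarith [key (n + 1), key (n - 1), key (partner m n + 1), key (partner m n - 1)]
  have : 0 < u n ^ 2 := by rw [← sq_abs]; positivity
  exact nonneg_of_mul_nonneg_left h2 this

theorem eigenvalue_lt {m : ℕ} (hm : 1 ≤ m) {lam : ℝ} {u : ZMod (Nm m) → ℝ}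
    (hu : u ∈ eigensp m lam) (h0 : u ≠ 0) : lam < 8 := by
  by_contra! h8
  obtain ⟨hl, hp⟩ := mem_eigensp.1 hu
  obtain ⟨n, hn⟩ := Finite.exists_max fun n => |u n|
  have hpos : 0 < |u n| := by
    obtain ⟨k, hk⟩ := Function.ne_iff.1 h0
    exact (abs_pos.2 hk).trans_le (hn k)
  have step : ∀ x, |u x| = |u n| → u (x + 1) = -u x := by
    intro x hx
    have key : ∀ k, -(u x * u k) ≤ u x ^ 2 := fun k => by
      rw [← sq_abs, sq]
      exact (neg_le_abs _).trans ((abs_mul _ _).trans_le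
        (mul_le_mul_of_nonneg_left (hx ▸ hn k) (abs_nonneg _)))
    have h := hl x
    rw [lap] at h
    have e : lam * u x ^ 2 = 4 * u x ^ 2 - u x * u (x + 1) - u x * u (x - 1)
      - u x * u (partner m x + 1) - u x * u (partner m x - 1) := by
      linear_combination -u x * h
    have h8' : 8 * u x ^ 2 ≤ lam * u x ^ 2 := mul_le_mul_of_nonneg_right h8 (sq_nonneg _)
    have h1 : u x * u (x + 1) = -(u x * u x) := by
      linarith [key (x + 1), key (x - 1), key (partner m x + 1), key (partner m x - 1)]
    have hx0 : u x ≠ 0 := abs_pos.1 (hx ▸ hpos)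
    exact mul_left_cancel₀ hx0 (by linarith)
  have hall : ∀ j : ℕ, |u (n + j)| = |u n| := by
    intro j
    induction j with
    | zero => simp
    | succ j ih => rw [Nat.cast_succ, ← add_assoc, step _ ih, abs_neg, ih]
  have h1 : |u 1| = |u n| := by
    have := hall (1 - n).val
    rwa [ZMod.natCast_zmod_val, add_sub_cancel] at this
  have h2 := step 1 h1
  have h3 := hp 1
  rw [partner_one hm] at h3
  rw [one_add_one_eq_two, h3] at h2
  have : u 1 = 0 := by linarith
  rw [this, abs_zero] at h1
  exact hpos.ne h1

theorem eigensp_le_eigenspace (m : ℕ) (lam : ℝ) :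
    eigensp m lam ≤ Module.End.eigenspace (lapL m) lam := by
  intro u hu
  rw [Module.End.mem_eigenspace_iff]
  exact funext (mem_eigensp.1 hu).1

theorem iSupIndep_eigensp (m : ℕ) : iSupIndep (eigensp m) :=
  (Module.End.eigenspaces_iSupIndep (lapL m)).mono (eigensp_le_eigenspace m)

theorem finite_eigenvalues (m : ℕ) : {lam : ℝ | eigensp m lam ≠ ⊥}.Finite := by
  refine (Module.End.finite_hasEigenvalue (lapL m)).subset fun lam h => ?_
  exact fun hb => h (eq_bot_iff.2 (hb ▸ eigensp_le_eigenspace m lam))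

/-- Averaging over identified pairs. -/
def pairAvg (m : ℕ) : (ZMod (Nm m) → ℝ) →ₗ[ℝ] (ZMod (Nm m) → ℝ) :=
  (1 / 2 : ℝ) • (LinearMap.id + LinearMap.funLeft ℝ ℝ (partner m))

theorem pairAvg_apply (m : ℕ) (u : ZMod (Nm m) → ℝ) (n : ZMod (Nm m)) :
    pairAvg m u n = (u n + u (partner m n)) / 2 := by
  simp [pairAvg, LinearMap.funLeft_apply]; ring

theorem pairAvg_partner (m : ℕ) (u : ZMod (Nm m) → ℝ) (n : ZMod (Nm m)) :
    pairAvg m u (partner m n) = pairAvg m u n := by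
  rw [pairAvg_apply, pairAvg_apply, partner_partner, add_comm]

theorem pairAvg_eq_self {m : ℕ} {u : ZMod (Nm m) → ℝ} (hu : ∀ n, u (partner m n) = u n) :
    pairAvg m u = u := by
  funext n
  rw [pairAvg_apply, hu]; ring

theorem lap_partner {m : ℕ} {u : ZMod (Nm m) → ℝ} (hu : ∀ n, u (partner m n) = u n)
    (n : ZMod (Nm m)) : lap m u (partner m n) = lap m u n := by
  simp only [lap, partner_partner, hu]; ring

theorem sum_comp_partner (m : ℕ) (f : ZMod (Nm m) → ℝ) :
    ∑ n, f (partner m n) = ∑ n, f n :=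
  Equiv.sum_comp (Function.Involutive.toPerm (partner m) (partner_partner m)) f

theorem sum_mul_pairAvg {m : ℕ} {f : ZMod (Nm m) → ℝ} (hf : ∀ n, f (partner m n) = f n)
    (v : ZMod (Nm m) → ℝ) : ∑ n, f n * pairAvg m v n = ∑ n, f n * v n := by
  have h := sum_comp_partner m fun n => f n * v n
  simp only [hf] at h
  simp only [pairAvg_apply, mul_div_assoc', mul_add, add_div, Finset.sum_add_distrib,
    ← Finset.sum_div, h]
  ring

theorem sum_lap_mul {m : ℕ} {f h : ZMod (Nm m) → ℝ} (hh : ∀ n, h (partner m n) = h n) :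
    ∑ n, lap m f n * h n =
      ∑ n, (4 * (f n * h n) - 2 * (f (n + 1) * h n + f n * h (n + 1))) := by
  have h1 := sum_comp_partner m fun n => f (n + 1) * h n
  have h2 := sum_comp_partner m fun n => f (n - 1) * h n
  have h3 := Equiv.sum_comp (Equiv.addRight (1 : ZMod (Nm m))) fun n => f (n - 1) * h n
  simp only [hh] at h1 h2
  simp only [Equiv.coe_addRight, add_sub_cancel_right] at h3
  simp only [lap, sub_mul, mul_assoc, mul_add, Finset.sum_sub_distrib, Finset.sum_add_distrib,
    ← Finset.mul_sum, h1, h2, ← h3]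
  ring

theorem sum_lap_mul_comm {m : ℕ} {f h : ZMod (Nm m) → ℝ} (hf : ∀ n, f (partner m n) = f n)
    (hh : ∀ n, h (partner m n) = h n) :
    ∑ n, lap m f n * h n = ∑ n, f n * lap m h n := by
  have e := sum_lap_mul (f := h) hf
  simp only [mul_comm (lap m h _)] at e
  rw [sum_lap_mul hh, e]
  exact Finset.sum_congr rfl fun n _ => by ring

/-- The Laplacian of the pair average, as an operator on Euclidean space. -/
def avgLap (m : ℕ) : EuclideanSpace ℝ (ZMod (Nm m)) →ₗ[ℝ] EuclideanSpace ℝ (ZMod (Nm m)) :=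
  (WithLp.linearEquiv 2 ℝ (ZMod (Nm m) → ℝ)).symm.toLinearMap ∘ₗ lapL m ∘ₗ pairAvg m ∘ₗ
    (WithLp.linearEquiv 2 ℝ (ZMod (Nm m) → ℝ)).toLinearMap

theorem avgLap_apply (m : ℕ) (u : EuclideanSpace ℝ (ZMod (Nm m))) :
    (avgLap m u).ofLp = lap m (pairAvg m u.ofLp) := rfl

theorem avgLap_isSymmetric (m : ℕ) : (avgLap m).IsSymmetric := by
  intro u v
  simp only [PiLp.inner_apply, avgLap_apply, RCLike.inner_apply, conj_trivial]
  have hu := pairAvg_partner m u.ofLp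
  have hv := pairAvg_partner m v.ofLp
  have e1 := sum_mul_pairAvg (lap_partner hu) v.ofLp
  have e2 := sum_mul_pairAvg (lap_partner hv) u.ofLp
  have e3 := sum_lap_mul_comm hu hv
  simp only [mul_comm (lap m _ _)] at e1 e2 e3
  rw [← e1, e3, e2]
  exact Finset.sum_congr rfl fun n _ => mul_comm _ _

theorem iSup_eigensp (m : ℕ) : ⨆ lam, eigensp m lam = KFunSub m := by
  refine le_antisymm (iSup_le fun lam => inf_le_right) fun u hu => ?_
  have htop : ⨆ lam, Module.End.eigenspace (avgLap m) lam = ⊤ :=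
    Submodule.orthogonal_eq_bot_iff.1
      (avgLap_isSymmetric m).orthogonalComplement_iSup_eigenspaces_eq_bot
  let Q := pairAvg m ∘ₗ (WithLp.linearEquiv 2 ℝ (ZMod (Nm m) → ℝ)).toLinearMap
  have hQ : ∀ lam, (Module.End.eigenspace (avgLap m) lam).map Q ≤ eigensp m lam := by
    rintro lam _ ⟨v, hv, rfl⟩
    have hv' := congrArg WithLp.ofLp (Module.End.mem_eigenspace_iff.1 hv)
    rw [avgLap_apply] at hv'
    refine mem_eigensp.2 ⟨fun n => ?_, pairAvg_partner m v.ofLp⟩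
    have hpart := lap_partner (pairAvg_partner m v.ofLp) n
    rw [hv'] at hpart
    have hn := congrFun hv' n
    simp only [WithLp.ofLp_smul, Pi.smul_apply, smul_eq_mul] at hn hpart
    change lap m (pairAvg m v.ofLp) n = lam * pairAvg m v.ofLp n
    rw [hn, pairAvg_apply]
    linear_combination -hpart / 2
  have hmem : u ∈ (⊤ : Submodule ℝ (EuclideanSpace ℝ (ZMod (Nm m)))).map Q :=
    ⟨WithLp.toLp 2 u, trivial, pairAvg_eq_self hu⟩
  rw [← htop, Submodule.map_iSup] at hmem
  exact iSup_mono hQ hmem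

theorem le_finrank_KFunSub (m : ℕ) : 5 ^ m ≤ Module.finrank ℝ (KFunSub m) := by
  have hlt : ∀ i : ℕ, i < Nm m → i / 2 < 5 ^ m := fun i hi => by unfold Nm at hi; omega
  let e : ZMod (Nm m) → Fin (5 ^ m) := fun n =>
    ⟨(if Even n.val then n else partner m n).val / 2, hlt _ (ZMod.val_lt _)⟩
  have he : ∀ n, e (partner m n) = e n := by
    intro n
    simp only [e, val_partner_even_iff, partner_partner]
    congr 3
    split_ifs <;> simp_all
  let f : (Fin (5 ^ m) → ℝ) →ₗ[ℝ] KFunSub m :=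
    (LinearMap.funLeft ℝ ℝ e).codRestrict (KFunSub m) fun w n => congrArg w (he n)
  have hf : Function.Injective f := by
    intro w w' h
    funext i
    have hval : (((2 * (i : ℕ) : ℕ)) : ZMod (Nm m)).val = 2 * i :=
      ZMod.val_natCast_of_lt (by unfold Nm; omega)
    have hi : e ((2 * (i : ℕ) : ℕ) : ZMod (Nm m)) = i := by
      apply Fin.ext
      simp only [e, hval, even_two_mul, if_true]
      omega
    have := congrFun (congrArg Subtype.val h) ((2 * (i : ℕ) : ℕ) : ZMod (Nm m))
    change w (e _) = w' (e _) at this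
    rwa [hi] at this
  simpa using LinearMap.finrank_le_finrank_of_injective hf

theorem evCount_mono (m : ℕ) : Monotone (evCount m) := fun _ _ h =>
  Submodule.finrank_mono (biSup_mono fun _ hx => le_trans hx h)

theorem eigensp_eq_bot_of_neg (m : ℕ) {lam : ℝ} (h : lam < 0) : eigensp m lam = ⊥ := by
  refine (Submodule.eq_bot_iff _).2 fun u hu => ?_
  by_contra h0
  exact (eigenvalue_nonneg hu h0).not_gt h

theorem evCount_of_neg (m : ℕ) {t : ℝ} (ht : t < 0) : evCount m t = 0 := by
  have : ⨆ lam ∈ Set.Iic t, eigensp m lam = ⊥ :=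
    (iSup₂_eq_bot).2 fun lam hlam => eigensp_eq_bot_of_neg m (lt_of_le_of_lt hlam ht)
  rw [evCount, this, finrank_bot]

theorem exists_le_evCount {m : ℕ} (hm : 1 ≤ m) : ∃ s < 8, 5 ^ m ≤ evCount m s := by
  obtain ⟨s, hs, hmax⟩ := Set.exists_max_image (insert 0 {lam : ℝ | eigensp m lam ≠ ⊥}) id
    ((finite_eigenvalues m).insert 0) (Set.insert_nonempty _ _)
  refine ⟨s, ?_, ?_⟩
  · rcases hs with rfl | hs
    · norm_num
    · obtain ⟨u, hu, h0⟩ := (Submodule.ne_bot_iff _).1 hs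
      exact eigenvalue_lt hm hu h0
  · have : KFunSub m ≤ ⨆ lam ∈ Set.Iic s, eigensp m lam := by
      rw [← iSup_eigensp]
      refine iSup_le fun lam => ?_
      by_cases h : eigensp m lam = ⊥
      · rw [h]; exact bot_le
      · exact le_iSup₂_of_le lam (hmax lam (Or.inr h)) le_rfl
    exact (le_finrank_KFunSub m).trans (Submodule.finrank_mono this)

theorem R_strictMonoOn : StrictMonoOn R (Set.Iic 1) := by
  intro a ha b hb hab
  simp only [Set.mem_Iic] at ha hb
  have h : 0 < a ^ 2 + a * b + b ^ 2 - 8 * (a + b) + 15 := by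
    nlinarith [sq_nonneg (a - b), sq_nonneg (a + b), mul_nonneg (sub_nonneg.2 ha) (sub_nonneg.2 hb)]
  have := mul_pos (sub_pos.2 hab) h
  simp only [R]
  linarith

theorem exists_R_eq {y : ℝ} (h0 : 0 ≤ y) (h8 : y < 8) : ∃ a, 0 ≤ a ∧ a < 1 ∧ R a = y := by
  have hc : ContinuousOn R (Set.Icc 0 1) := by unfold R; fun_prop
  obtain ⟨a, ⟨ha0, ha1⟩, rfl⟩ := intermediate_value_Icc zero_le_one hc
    (show y ∈ Set.Icc (R 0) (R 1) by norm_num [R]; exact ⟨h0, h8.le⟩)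
  refine ⟨a, ha0, lt_of_le_of_ne ha1 ?_, rfl⟩
  rintro rfl
  norm_num [R] at h8

theorem phi1_R {a : ℝ} (h0 : 0 ≤ a) (h1 : a < 1) : phi1 (R a) = a := by
  have hs : (4.34 : ℝ) ≤ Real.sqrt 19 := Real.le_sqrt_of_sq_le (by norm_num)
  have hs' : Real.sqrt 19 ≤ 5 := Real.sqrt_le_iff.2 (by norm_num)
  have hmem : a ∈ Set.Icc 0 cpt := ⟨h0, by unfold cpt; linarith⟩
  have hex : ∃ x ∈ Set.Icc 0 cpt, R x = R a := ⟨a, hmem, rfl⟩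
  obtain ⟨hy0, hy1⟩ : phi1 (R a) ∈ Set.Icc 0 cpt := Function.invFunOn_mem hex
  have hR : R (phi1 (R a)) = R a := Function.invFunOn_eq hex
  generalize phi1 (R a) = y at *
  have hy : y ≤ 1.22 := by unfold cpt at hy1; linarith
  have hpos : 0 < y ^ 2 + y * a + a ^ 2 - 8 * (y + a) + 15 := by
    nlinarith [mul_nonneg (sub_nonneg.2 hy) (sub_nonneg.2 h1.le), sq_nonneg (y - 1.22),
      sq_nonneg (a - 1)]
  have : (y - a) * (y ^ 2 + y * a + a ^ 2 - 8 * (y + a) + 15) = 0 := by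
    simp only [R] at hR; linarith
  exact sub_eq_zero.1 ((mul_eq_zero.1 this).resolve_right hpos.ne')

theorem one_sub_mul_three_sub_ne_zero {mu : ℝ} (h : mu < 1) : (1 - mu) * (3 - mu) ≠ 0 :=
  (mul_pos (by linarith) (by linarith)).ne'

theorem map_downL_iSup (m : ℕ) {t : ℝ} (h1 : t < 1) :
    (⨆ mu ∈ Set.Iic t, eigensp (m + 1) mu).map (downL m) =
      ⨆ lam ∈ Set.Iic (R t), eigensp m lam := by
  simp only [Submodule.map_iSup]
  refine le_antisymm (iSup₂_le fun mu hmu => ?_) (iSup₂_le fun lam hlam => ?_)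
  · have hmu1 : mu < 1 := lt_of_le_of_lt hmu h1
    rw [map_downL_eigensp (one_sub_mul_three_sub_ne_zero hmu1)]
    exact le_iSup₂_of_le (R mu) (R_strictMonoOn.monotoneOn hmu1.le h1.le hmu) le_rfl
  · rcases lt_or_ge lam 0 with hneg | hnn
    · rw [eigensp_eq_bot_of_neg m hneg]; exact bot_le
    · have hR8 : R t < 8 := by
        have := R_strictMonoOn h1.le (Set.mem_Iic.2 le_rfl) h1
        norm_num [R] at this ⊢; exact this
      obtain ⟨mu, -, hmu1, rfl⟩ := exists_R_eq hnn (lt_of_le_of_lt hlam hR8)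
      refine le_iSup₂_of_le mu ((R_strictMonoOn.le_iff_le hmu1.le h1.le).1 hlam) ?_
      rw [map_downL_eigensp (one_sub_mul_three_sub_ne_zero hmu1)]

theorem eq_zero_of_mem_iSup (m : ℕ) {t : ℝ} (h1 : t < 1) {v : ZMod (Nm (m + 1)) → ℝ}
    (hv : v ∈ ⨆ mu ∈ Set.Iic t, eigensp (m + 1) mu) (h : downL m v = 0) : v = 0 := by
  rw [iSup_subtype'] at hv
  obtain ⟨f, hf, rfl⟩ := (Submodule.mem_iSup_iff_exists_finsupp _ _).1 hv
  have hlt : ∀ i : Set.Iic t, (i : ℝ) < 1 := fun i => lt_of_le_of_lt i.2 h1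
  have hinj : Function.Injective fun i : Set.Iic t => R i := fun i j hij =>
    Subtype.ext (R_strictMonoOn.injOn (hlt i).le (hlt j).le hij)
  have hind := (iSupIndep_eigensp m).comp hinj
  rw [iSupIndep_iff_finsetSum_eq_zero_imp_eq_zero] at hind
  rw [Finsupp.sum, map_sum] at h
  have hz := hind f.support (fun i => downL m (f i)) (fun i _ => downL_mem_eigensp (hf i)) h
  exact Finset.sum_eq_zero fun i hi =>
    eq_zero_of_downL_eq_zero (one_sub_mul_three_sub_ne_zero (hlt i)) (hf i) (hz i hi)

theorem evCount_succ (m : ℕ) {t : ℝ} (h1 : t < 1) : evCount (m + 1) t = evCount m (R t) := by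
  rw [evCount, evCount, ← map_downL_iSup m h1, ← LinearMap.range_domRestrict,
    LinearMap.finrank_range_of_inj]
  rw [← LinearMap.ker_eq_bot, LinearMap.ker_eq_bot']
  exact fun v hv => Subtype.ext (eq_zero_of_mem_iSup m h1 v.2 hv)

/-- For `1 ≤ k ≤ 5^m`, `λ_k(m+1) = φ₁(λ_k(m))`: the `5^m` smallest
eigenvalues of `−Δ_{m+1}` come from applying `φ₁` to the eigenvalues of `−Δ_m`. -/
theorem sorted_eigenvalues_decimate (m : ℕ) (hm : 1 ≤ m) (k : ℕ)
    (hk1 : 1 ≤ k) (hk : k ≤ 5 ^ m) :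
    evSorted (m + 1) k = phi1 (evSorted m k) := by
  obtain ⟨s, hs8, hs⟩ := exists_le_evCount hm
  have hsmem : k ≤ evCount m s := hk.trans hs
  have hlow : ∀ t, k ≤ evCount m t → 0 ≤ t := fun t ht => by
    by_contra! hneg
    rw [evCount_of_neg m hneg] at ht
    omega
  have hbdd : BddBelow {t : ℝ | k ≤ evCount m t} := ⟨0, hlow⟩
  obtain ⟨a, ha0, ha1, ha⟩ := exists_R_eq
    (Real.sInf_nonneg (s := {t : ℝ | k ≤ evCount m t}) hlow)
    ((csInf_le hbdd hsmem).trans_lt hs8)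
  change evSorted (m + 1) k = phi1 (sInf {t : ℝ | k ≤ evCount m t})
  rw [← ha, phi1_R ha0 ha1]
  have hlower : ∀ t, k ≤ evCount (m + 1) t → a ≤ t := fun t ht => by
    by_contra! hta
    have ht1 := hta.trans ha1
    rw [evCount_succ m ht1] at ht
    have hR := R_strictMonoOn ht1.le ha1.le hta
    rw [ha] at hR
    exact hR.not_ge (csInf_le hbdd ht)
  have hupper : ∀ t, a < t → t < 1 → k ≤ evCount (m + 1) t := fun t hat ht1 => by
    have hR := R_strictMonoOn ha1.le ht1.le hat
    rw [ha] at hR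
    obtain ⟨r, hr, hrt⟩ := exists_lt_of_csInf_lt ⟨s, hsmem⟩ hR
    rw [evCount_succ m ht1]
    exact le_trans hr (evCount_mono m hrt.le)
  refine le_antisymm (le_of_forall_gt_imp_ge_of_dense fun t hat => ?_) ?_
  · obtain ⟨r, har, hr⟩ := exists_between (lt_min hat ha1)
    exact (csInf_le ⟨a, hlower⟩ (hupper r har (hr.trans_le (min_le_right _ _)))).trans
      (hr.le.trans (min_le_left _ _))
  · obtain ⟨r, har, hr⟩ := exists_between ha1
    exact le_csInf ⟨r, hupper r har hr⟩ hlower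

end VNLE
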